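/- Let q > 1 be a real number and k ≥ 2 an integer. With (1/q)_m = ∏_{j=1}^m (1 − q^{−j}), the sum over all (k−1)-tuples of nonnegative integers (n₁, …, n_{k−1}) of 1/(q^{N₁² + ⋯ + N_{k−1}²} · (1/q)_{n₁} ⋯ (1/q)_{n_{k−1}}), where N_i = n_i + n_{i+1} + ⋯ + n_{k−1}, equals ∏_{r ≥ 1, r ≢ 0, ±k (mod 2k+1)} 1/(1 − q^{−r}) (the Andrews–Gordon identity). -/

import Mathlib

/-- `(1/q)_m = ∏_{j=1}^m (1 − q^{−j})`. -/
noncomputable def qPochOne (q : ℝ) (m : ℕ) : ℝ := ∏ j ∈ Finset.range m, (1 - q⁻¹ ^ (j + 1))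

namespace AG

/-- `1/(x)_z` for `z ≥ 0`, and `0` for `z < 0`. -/
noncomputable def u (x : ℝ) (z : ℤ) : ℝ :=
  if z < 0 then 0 else (∏ j ∈ Finset.range z.toNat, (1 - x ^ (j + 1)))⁻¹

lemma u_neg (x : ℝ) {z : ℤ} (h : z < 0) : u x z = 0 := by simp [u, h]

lemma u_nat (x : ℝ) (n : ℕ) : u x n = (∏ j ∈ Finset.range n, (1 - x ^ (j + 1)))⁻¹ := by
  simp [u]

lemma u_zero (x : ℝ) : u x 0 = 1 := by simp [u]

lemma one_sub_pos {x : ℝ} (h0 : 0 < x) (h1 : x < 1) (j : ℕ) : 0 < 1 - x ^ (j + 1) := by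
  have := pow_lt_one₀ h0.le h1 (n := j + 1) (by omega)
  linarith

lemma u_pred {x : ℝ} (h0 : 0 < x) (h1 : x < 1) (z : ℤ) : u x (z - 1) = (1 - x ^ z) * u x z := by
  rcases lt_trichotomy z 0 with h | h | h
  · rw [u_neg x h, u_neg x (by omega)]; simp
  · subst h; rw [u_neg x (by omega)]; simp
  · obtain ⟨n, rfl⟩ : ∃ n : ℕ, z = (n + 1 : ℕ) := ⟨(z - 1).toNat, by omega⟩
    have e : ((n + 1 : ℕ) : ℤ) - 1 = (n : ℕ) := by push_cast; ring
    rw [e, u_nat, u_nat, Finset.prod_range_succ, zpow_natCast, mul_inv]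
    have := (one_sub_pos h0 h1 n).ne'
    field_simp

lemma zpow_ne_one' {x : ℝ} (h0 : 0 < x) (h1 : x < 1) {z : ℤ} (hz : z ≠ 0) : 1 - x ^ z ≠ 0 := by
  intro h
  have h' : x ^ z = x ^ (0 : ℤ) := by rw [zpow_zero]; linarith
  exact hz (zpow_right_injective₀ h0 h1.ne h')

/-- q-Chu-Vandermonde, the kernel of the Bailey lemma. -/
lemma kernel {x : ℝ} (h0 : 0 < x) (h1 : x < 1) (n : ℕ) (r : ℤ) :
    ∑ j ∈ Finset.range (n + 1), x ^ (j ^ 2) * u x ((n : ℤ) - j) * (u x (j - r) * u x (j + r))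
      = x ^ (r ^ 2) * (u x (n - r) * u x (n + r)) := by
  have hx := h0.ne'
  induction n with
  | zero =>
    rcases eq_or_ne r 0 with rfl | hr
    · simp [u_zero]
    · rcases lt_or_gt_of_ne hr with h | h
      · simp [u_neg x h]
      · simp [u_neg x (show -r < 0 by omega)]
  | succ n ih =>
    by_cases hr : ((n + 1 : ℕ) : ℤ) = r ∨ ((n + 1 : ℕ) : ℤ) = -r
    · rw [Finset.sum_eq_single_of_mem (n + 1) (by simp)]
      · rw [sub_self, u_zero, mul_one]
        congr 1
        have : r ^ 2 = (((n + 1) ^ 2 : ℕ) : ℤ) := by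
          rcases hr with h | h
          · rw [← h]; push_cast; ring
          · rw [← neg_sq, ← h]; push_cast; ring
        rw [this, zpow_natCast]
      · intro j hj hj'
        have : j < n + 1 := by simp at hj; omega
        rcases hr with h | h
        · rw [u_neg x (show (j : ℤ) - r < 0 by omega)]; simp
        · rw [u_neg x (show (j : ℤ) + r < 0 by omega)]; simp
    · push Not at hr
      set m : ℤ := ((n + 1 : ℕ) : ℤ) with hm
      have hmn : (n : ℤ) = m - 1 := by rw [hm]; push_cast; ring
      have f1 : 1 - x ^ (m - r) ≠ 0 := zpow_ne_one' h0 h1 (by omega)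
      have f2 : 1 - x ^ (m + r) ≠ 0 := zpow_ne_one' h0 h1 (by omega)
      rw [hmn] at ih
      have e1 : u x (m - 1 - r) = (1 - x ^ (m - r)) * u x (m - r) := by
        rw [← u_pred h0 h1]; congr 1; ring
      have e2 : u x (m - 1 + r) = (1 - x ^ (m + r)) * u x (m + r) := by
        rw [← u_pred h0 h1]; congr 1; ring
      rw [e1, e2] at ih
      apply mul_left_cancel₀ (mul_ne_zero f1 f2)
      have rhs : (1 - x ^ (m - r)) * (1 - x ^ (m + r)) * (x ^ r ^ 2 * (u x (m - r) * u x (m + r)))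
        = x ^ r ^ 2 * ((1 - x ^ (m - r)) * u x (m - r) * ((1 - x ^ (m + r)) * u x (m + r))) := by
          ring
      rw [rhs, ← ih]
      let G : ℕ → ℝ := fun j => - (x ^ (m - j) * x ^ (j ^ 2) * u x (m - j) *
        (u x (j - 1 - r) * u x (j - 1 + r)))
      have key : ∀ j : ℕ, (1 - x ^ (m - r)) * (1 - x ^ (m + r)) *
          (x ^ (j ^ 2) * u x (m - j) * (u x (j - r) * u x (j + r)))
          - x ^ (j ^ 2) * u x (m - 1 - j) * (u x (j - r) * u x (j + r)) = G (j + 1) - G j := by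
        intro j
        simp only [G]
        have a1 : u x (m - 1 - j) = (1 - x ^ (m - j)) * u x (m - j) := by
          rw [← u_pred h0 h1]; congr 1; ring
        have a2 : u x ((j : ℤ) - 1 - r) = (1 - x ^ ((j : ℤ) - r)) * u x (j - r) := by
          rw [← u_pred h0 h1]; congr 1; ring
        have a3 : u x ((j : ℤ) - 1 + r) = (1 - x ^ ((j : ℤ) + r)) * u x (j + r) := by
          rw [← u_pred h0 h1]; congr 1; ring
        have a4 : ((j + 1 : ℕ) : ℤ) - 1 = j := by push_cast; ring
        have a5 : m - ((j + 1 : ℕ) : ℤ) = m - 1 - j := by push_cast; ring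
        rw [a4, a5, a1, a2, a3]
        have b1 : x ^ (m - 1 - j) * x ^ ((j + 1) ^ 2) = x ^ m * x ^ j * x ^ (j ^ 2) := by
          rw [← zpow_natCast, ← zpow_natCast, ← zpow_natCast, ← zpow_add₀ hx, ← zpow_add₀ hx,
            ← zpow_add₀ hx]
          congr 1; push_cast; ring
        rw [b1]
        simp only [zpow_sub₀ hx, zpow_add₀ hx, zpow_natCast]
        have c1 : x ^ r ≠ 0 := zpow_ne_zero _ hx
        field_simp
        ring
      have S : ∑ j ∈ Finset.range (n + 1 + 1), (G (j + 1) - G j) = 0 := by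
        rw [Finset.sum_range_sub]
        simp only [G]
        rw [u_neg x (show m - ((n + 1 + 1 : ℕ) : ℤ) < 0 by omega)]
        rcases le_or_gt 0 r with h | h
        · rw [u_neg x (show ((0 : ℕ) : ℤ) - 1 - r < 0 by push_cast; omega)]; simp
        · rw [u_neg x (show ((0 : ℕ) : ℤ) - 1 + r < 0 by push_cast; omega)]; simp
      rw [← Finset.sum_congr rfl (fun j _ => key j), Finset.sum_sub_distrib, ← Finset.mul_sum,
        sub_eq_zero] at S
      rw [S, Finset.sum_range_succ, u_neg x (show m - 1 - ((n + 1 : ℕ) : ℤ) < 0 by omega)]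
      simp

lemma fin_supp (x : ℝ) (c : ℤ → ℝ) (n : ℤ) :
    Summable fun r : ℤ => c r * (u x (n - r) * u x (n + r)) := by
  apply summable_of_hasFiniteSupport
  apply (Set.finite_Icc (-n) n).subset
  intro r hr
  by_contra hh
  rw [Set.mem_Icc, not_and_or] at hh
  apply hr
  rcases hh with h | h
  · simp [u_neg x (show n + r < 0 by omega)]
  · simp [u_neg x (show n - r < 0 by omega)]

/-- theta coefficients -/
noncomputable def c (x z : ℝ) (r : ℤ) : ℝ := (-1) ^ r * x ^ (r * (r - 1) / 2) * z ^ r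

lemma c_succ {x z : ℝ} (hx : x ≠ 0) (hz : z ≠ 0) (r : ℤ) :
    c x z (r + 1) = - (x ^ r * z * c x z r) := by
  have : (r + 1) * (r + 1 - 1) / 2 = r * (r - 1) / 2 + r := by
    rw [show (r + 1) * (r + 1 - 1) = r * (r - 1) + r * 2 by ring,
      Int.add_mul_ediv_right _ _ (by norm_num)]
  rw [c, c, this, zpow_add₀ hx, zpow_add₀ hz, zpow_add₀ (by norm_num : (-1 : ℝ) ≠ 0)]
  simp; ring

/-- Finite Jacobi triple product. -/
lemma finite_jtp {x z : ℝ} (h0 : 0 < x) (h1 : x < 1) (hz : z ≠ 0) (n : ℕ) :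
    ∑' r : ℤ, c x z r * (u x (n - r) * u x (n + r)) =
      (∏ i ∈ Finset.range n, ((1 - z * x ^ i) * (1 - x ^ (i + 1) / z))) * u x (2 * n : ℕ) := by
  have hx := h0.ne'
  induction n with
  | zero =>
    rw [tsum_eq_single 0]
    · simp [c, u_zero]
    · intro r hr
      rcases lt_or_gt_of_ne hr with h | h
      · simp [u_neg x h]
      · simp [u_neg x (show -r < 0 by omega)]
  | succ n ih =>
    set e : ℤ → ℝ := fun r => u x (n - r) * u x (n + r) with he
    have s1 : Summable fun r => c x z r * e r := fin_supp x (c x z) n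
    have s2 : Summable fun r => c x z (r + 1) * x ^ ((n : ℤ) - r) * e r :=
      fin_supp x (fun r => c x z (r + 1) * x ^ ((n : ℤ) - r)) n
    have s3 : Summable fun r => c x z (r - 1) * x ^ ((n : ℤ) + r) * e r :=
      fin_supp x (fun r => c x z (r - 1) * x ^ ((n : ℤ) + r)) n
    have s2' := (Equiv.subRight (1 : ℤ)).summable_iff.mpr s2
    have s3' := (Equiv.addRight (1 : ℤ)).summable_iff.mpr s3
    have t2 := (Equiv.subRight (1 : ℤ)).tsum_eq
      (fun r => c x z (r + 1) * x ^ ((n : ℤ) - r) * e r)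
    have t3 := (Equiv.addRight (1 : ℤ)).tsum_eq
      (fun r => c x z (r - 1) * x ^ ((n : ℤ) + r) * e r)
    simp only [Equiv.subRight_apply, Equiv.coe_addRight, Function.comp_def] at t2 t3 s2' s3'
    have step : (1 - x ^ (2 * n + 1)) * (1 - x ^ (2 * n + 2)) *
        ∑' r : ℤ, c x z r * (u x ((n + 1 : ℕ) - r) * u x ((n + 1 : ℕ) + r))
        = (1 - z * x ^ n) * (1 - x ^ (n + 1) / z) * ∑' r : ℤ, c x z r * e r := by
      have A : (1 - z * x ^ n) * (1 - x ^ (n + 1) / z) * ∑' r : ℤ, c x z r * e r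
          = (1 + x ^ (2 * n + 1)) * ∑' r : ℤ, c x z r * e r
            + ∑' r : ℤ, c x z (r + 1) * x ^ ((n : ℤ) - r) * e r
            + ∑' r : ℤ, c x z (r - 1) * x ^ ((n : ℤ) + r) * e r := by
        rw [← tsum_mul_left, ← tsum_mul_left, ← (s1.mul_left _).tsum_add s2,
          ← ((s1.mul_left _).add s2).tsum_add s3]
        congr 1; ext r
        have q1 := c_succ hx hz r
        have q2 := c_succ hx hz (r - 1)
        rw [sub_add_cancel] at q2
        have q3 : c x z (r - 1) = - (c x z r / (x ^ (r - 1) * z)) := by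
          rw [q2]
          have := zpow_ne_zero (r - 1) hx
          field_simp
        rw [q1, q3]
        simp only [zpow_sub₀ hx, zpow_add₀ hx, zpow_natCast, zpow_one]
        have c1 : x ^ r ≠ 0 := zpow_ne_zero _ hx
        field_simp
        ring
      rw [A, ← t2, ← t3, ← tsum_mul_left, ← tsum_mul_left, ← (s1.mul_left _).tsum_add s2',
        ← ((s1.mul_left _).add s2').tsum_add s3']
      congr 1; ext r
      simp only [he, sub_add_cancel, add_sub_cancel_right]
      set m : ℤ := ((n + 1 : ℕ) : ℤ) with hm
      have hmn : (n : ℤ) = m - 1 := by rw [hm]; push_cast; ring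
      have w1 : u x ((n : ℤ) - r) = (1 - x ^ (m - r)) * u x (m - r) := by
        rw [← u_pred h0 h1, hmn]; congr 1; ring
      have w2 : u x ((n : ℤ) + r) = (1 - x ^ (m + r)) * u x (m + r) := by
        rw [← u_pred h0 h1, hmn]; congr 1; ring
      have w3 : u x ((n : ℤ) - (r - 1)) = u x (m - r) := by
        rw [hmn]; congr 1; ring
      have w4 : u x ((n : ℤ) + (r + 1)) = u x (m + r) := by
        rw [hmn]; congr 1; ring
      have w5 : u x ((n : ℤ) - (r + 1)) = (1 - x ^ (n - r)) * u x ((n : ℤ) - r) := by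
        rw [← u_pred h0 h1]; congr 1; ring
      have w6 : u x ((n : ℤ) + (r - 1)) = (1 - x ^ (n + r)) * u x ((n : ℤ) + r) := by
        rw [← u_pred h0 h1]; congr 1; ring
      rw [w5, w6, w3, w4, w1, w2]
      have v1 : x ^ (m - r) = x ^ n * x / x ^ r := by
        rw [zpow_sub₀ hx, hm, zpow_natCast, pow_succ]
      have v2 : x ^ (m + r) = x ^ n * x * x ^ r := by
        rw [zpow_add₀ hx, hm, zpow_natCast, pow_succ]
      rw [v1, v2]
      simp only [zpow_sub₀ hx, zpow_add₀ hx, zpow_natCast, zpow_one]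
      have c1 : x ^ r ≠ 0 := zpow_ne_zero _ hx
      field_simp
      ring
    have p1 := one_sub_pos h0 h1 (2 * n)
    have p2 := one_sub_pos h0 h1 (2 * n + 1)
    apply mul_left_cancel₀ (mul_pos p1 p2).ne'
    rw [step, ih, Finset.prod_range_succ]
    have k : u x (2 * n : ℕ) = (1 - x ^ (2 * n + 1)) * ((1 - x ^ (2 * n + 2)) *
        u x (2 * (n + 1) : ℕ)) := by
      have r1 := u_pred h0 h1 (2 * n + 1 : ℕ)
      have r2 := u_pred h0 h1 (2 * n + 2 : ℕ)
      rw [zpow_natCast] at r1 r2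
      rw [show ((2 * (n + 1) : ℕ) : ℤ) = (2 * n + 2 : ℕ) by push_cast; ring, ← r2,
        show ((2 * n + 2 : ℕ) : ℤ) - 1 = (2 * n + 1 : ℕ) by push_cast; ring, ← r1]
      congr 1; push_cast; ring
    rw [k]
    ring

/-- Iterated Bailey chain. -/
noncomputable def B (x : ℝ) : ℕ → ℕ → ℝ
  | 0, n => if n = 0 then 1 else 0
  | m + 1, n => ∑ j ∈ Finset.range (n + 1), x ^ (j ^ 2) * u x ((n : ℤ) - j) * B x m j

/-- coefficients `α_k(r)` -/
noncomputable def al (x : ℝ) (k : ℕ) (r : ℤ) : ℝ := c x 1 r * x ^ (k * r ^ 2)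

lemma B_eq {x : ℝ} (h0 : 0 < x) (h1 : x < 1) (k n : ℕ) :
    B x k n = ∑' r : ℤ, al x k r * (u x (n - r) * u x (n + r)) := by
  induction k generalizing n with
  | zero =>
    have := finite_jtp h0 h1 one_ne_zero n
    simp only [al, Nat.cast_zero, zero_mul, zpow_zero, mul_one]
    rw [this, B]
    split_ifs with h
    · subst h; simp [u_zero]
    · rw [Finset.prod_eq_zero (i := 0)] <;> simp; omega
  | succ k ih =>
    rw [B]
    simp only [ih, ← tsum_mul_left]
    rw [← Summable.tsum_finsetSum (fun j _ => (fin_supp x _ _).mul_left _)]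
    congr 1; ext r
    have := kernel h0 h1 n r
    have e : al x (k + 1) r = al x k r * x ^ (r ^ 2) := by
      rw [al, al, mul_assoc, ← zpow_add₀ h0.ne']; congr 2; push_cast; ring
    rw [e, mul_assoc (al x k r), ← this, Finset.mul_sum]
    apply Finset.sum_congr rfl
    intros; ring

open Filter Topology

/-- `(x)_∞` -/
noncomputable def P (x : ℝ) : ℝ := ∏' j : ℕ, (1 - x ^ (j + 1))

lemma summ_pow {x : ℝ} (h0 : 0 < x) (h1 : x < 1) : Summable fun j : ℕ => ‖-x ^ (j + 1)‖ := by
  have := (summable_nat_add_iff 1).mpr (summable_geometric_of_lt_one h0.le h1)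
  refine this.congr fun j => ?_
  rw [norm_neg, Real.norm_of_nonneg (by positivity)]

lemma P_tendsto {x : ℝ} (h0 : 0 < x) (h1 : x < 1) :
    Tendsto (fun n => ∏ j ∈ Finset.range n, (1 - x ^ (j + 1))) atTop (𝓝 (P x)) := by
  have := (multipliable_one_add_of_summable (summ_pow h0 h1)).tendsto_prod_tprod_nat
  simp only [← sub_eq_add_neg] at this
  exact this

lemma P_pos {x : ℝ} (h0 : 0 < x) (h1 : x < 1) : 0 < P x := by
  have a : 0 ≤ P x := ge_of_tendsto' (P_tendsto h0 h1)
    fun n => Finset.prod_nonneg fun j _ => (one_sub_pos h0 h1 j).le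
  have b := tprod_one_add_ne_zero_of_summable (f := fun j : ℕ => -x ^ (j + 1))
    (fun j => by rw [← sub_eq_add_neg]; exact (one_sub_pos h0 h1 j).ne') (summ_pow h0 h1)
  simp only [← sub_eq_add_neg] at b
  exact lt_of_le_of_ne a (Ne.symm b)

lemma u_nonneg {x : ℝ} (h0 : 0 < x) (h1 : x < 1) (z : ℤ) : 0 ≤ u x z := by
  unfold u
  split_ifs
  · exact le_rfl
  · exact inv_nonneg.mpr (Finset.prod_nonneg fun j _ => (one_sub_pos h0 h1 j).le)

lemma u_le {x : ℝ} (h0 : 0 < x) (h1 : x < 1) (z : ℤ) : u x z ≤ (P x)⁻¹ := by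
  unfold u
  split_ifs
  · exact inv_nonneg.mpr (P_pos h0 h1).le
  · apply inv_anti₀ (P_pos h0 h1)
    have anti : Antitone fun n => ∏ j ∈ Finset.range n, (1 - x ^ (j + 1)) := by
      apply antitone_nat_of_succ_le
      intro n
      rw [Finset.prod_range_succ]
      apply mul_le_of_le_one_right (Finset.prod_nonneg fun j _ => (one_sub_pos h0 h1 j).le)
      have : 0 < x ^ (n + 1) := by positivity
      linarith
    exact anti.le_of_tendsto (P_tendsto h0 h1) _

lemma u_tendsto {x : ℝ} (h0 : 0 < x) (h1 : x < 1) :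
    Tendsto (u x) atTop (𝓝 (P x)⁻¹) := by
  have h := (P_tendsto h0 h1).inv₀ (P_pos h0 h1).ne'
  have h2 : Tendsto Int.toNat atTop atTop := by
    apply tendsto_atTop.mpr
    intro b
    filter_upwards [eventually_ge_atTop (b : ℤ)] with z hz
    omega
  refine (h.comp h2).congr' ?_
  filter_upwards [eventually_ge_atTop (0 : ℤ)] with z hz
  simp [u, not_lt.mpr hz]

lemma tannery {x : ℝ} (h0 : 0 < x) (h1 : x < 1) (a : ℤ → ℝ) (ha : Summable fun r => ‖a r‖) :
    Tendsto (fun n : ℕ => ∑' r : ℤ, a r * (u x (n - r) * u x (n + r))) atTop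
      (𝓝 ((∑' r, a r) * ((P x)⁻¹ * (P x)⁻¹))) := by
  rw [← tsum_mul_right]
  apply tendsto_tsum_of_dominated_convergence (bound := fun r => ‖a r‖ * ((P x)⁻¹ * (P x)⁻¹))
    (ha.mul_right _)
  · intro r
    apply Tendsto.const_mul
    apply Tendsto.mul
    · exact (u_tendsto h0 h1).comp
        (tendsto_atTop_add_const_right _ (-r) tendsto_natCast_atTop_atTop)
    · exact (u_tendsto h0 h1).comp
        (tendsto_atTop_add_const_right _ r tendsto_natCast_atTop_atTop)
  · refine Eventually.of_forall fun n r => ?_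
    rw [norm_mul, norm_mul, Real.norm_of_nonneg (u_nonneg h0 h1 _),
      Real.norm_of_nonneg (u_nonneg h0 h1 _)]
    have := inv_nonneg.mpr (P_pos h0 h1).le
    gcongr
    · exact u_nonneg h0 h1 _
    · exact u_le h0 h1 _
    · exact u_le h0 h1 _

lemma al_summable {x : ℝ} (h0 : 0 < x) (h1 : x < 1) (k : ℕ) (hk : 1 ≤ k) :
    Summable fun r => ‖al x k r‖ := by
  have hs : Summable fun r : ℤ => x ^ r.natAbs := by
    apply Summable.of_nat_of_neg <;> simpa using summable_geometric_of_lt_one h0.le h1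
  refine Summable.of_nonneg_of_le (fun _ => norm_nonneg _) (fun r => ?_) hs
  rw [al, c]
  simp only [one_zpow, mul_one, norm_mul, norm_zpow, norm_neg, norm_one, one_mul]
  rw [Real.norm_of_nonneg h0.le, ← zpow_add₀ h0.ne', ← zpow_natCast]
  apply zpow_le_zpow_right_of_le_one₀ h0 h1.le
  have e1 : 0 ≤ r * (r - 1) / 2 := by
    apply Int.ediv_nonneg _ (by norm_num)
    rcases le_or_gt r 0 with h | h <;> nlinarith
  have e2 : (r.natAbs : ℤ) ≤ r ^ 2 := by
    rw [Int.natCast_natAbs, ← sq_abs]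
    rcases eq_or_ne r 0 with rfl | h
    · simp
    · have := Int.one_le_abs h
      nlinarith
  have e3 : r ^ 2 ≤ k * r ^ 2 := by
    have : (1 : ℤ) ≤ k := by exact_mod_cast hk
    nlinarith [sq_nonneg r]
  linarith

lemma B_tendsto {x : ℝ} (h0 : 0 < x) (h1 : x < 1) (k : ℕ) (hk : 1 ≤ k) :
    Tendsto (B x k) atTop (𝓝 ((∑' r, al x k r) * ((P x)⁻¹ * (P x)⁻¹))) := by
  have := tannery h0 h1 _ (al_summable h0 h1 k hk)
  exact this.congr fun n => (B_eq h0 h1 k n).symm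

lemma S_summable {x : ℝ} (h0 : 0 < x) (h1 : x < 1) (m : ℕ) (hm : 1 ≤ m) :
    Summable fun j : ℕ => ‖x ^ (j ^ 2) * B x m j‖ := by
  obtain ⟨C, hC⟩ := (Metric.isBounded_range_of_tendsto _ (B_tendsto h0 h1 m hm)).exists_norm_le
  refine Summable.of_nonneg_of_le (fun _ => norm_nonneg _) (fun j => ?_)
    ((summable_geometric_of_lt_one h0.le h1).mul_right C)
  rw [norm_mul, Real.norm_of_nonneg (by positivity)]
  apply mul_le_mul _ (hC _ ⟨j, rfl⟩) (norm_nonneg _) (by positivity)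
  apply pow_le_pow_of_le_one h0.le h1.le
  nlinarith [Nat.le_mul_self j]

lemma S_eq {x : ℝ} (h0 : 0 < x) (h1 : x < 1) (m : ℕ) (hm : 1 ≤ m) :
    (∑' j : ℕ, x ^ (j ^ 2) * B x m j) = (∑' r, al x (m + 1) r) * (P x)⁻¹ := by
  have t1 := B_tendsto h0 h1 (m + 1) (by omega)
  have t2 : Tendsto (fun n : ℕ => ∑' j : ℕ, x ^ (j ^ 2) * B x m j * u x ((n : ℤ) - j)) atTop
      (𝓝 (∑' j : ℕ, x ^ (j ^ 2) * B x m j * (P x)⁻¹)) := by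
    apply tendsto_tsum_of_dominated_convergence
      (bound := fun j => ‖x ^ (j ^ 2) * B x m j‖ * (P x)⁻¹) ((S_summable h0 h1 m hm).mul_right _)
    · intro r
      apply Tendsto.const_mul
      exact (u_tendsto h0 h1).comp
        (tendsto_atTop_add_const_right _ (-(r : ℤ)) tendsto_natCast_atTop_atTop)
    · refine Eventually.of_forall fun n r => ?_
      rw [norm_mul, Real.norm_of_nonneg (u_nonneg h0 h1 _)]
      exact mul_le_mul_of_nonneg_left (u_le h0 h1 _) (norm_nonneg _)
  have t3 := t2.congr (f₂ := B x (m + 1)) (fun n => by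
    rw [B, tsum_eq_sum (s := Finset.range (n + 1))]
    · exact Finset.sum_congr rfl fun j _ => by ring
    · intro j hj
      simp at hj
      rw [u_neg x (by omega), mul_zero])
  have := tendsto_nhds_unique t3 t1
  rw [tsum_mul_right, ← mul_assoc] at this
  exact mul_right_cancel₀ (inv_ne_zero (P_pos h0 h1).ne') this

/-- The summand. -/
noncomputable def w (q : ℝ) (m : ℕ) (n : Fin m → ℕ) : ℝ :=
  (q ^ (∑ i : Fin m, (∑ j : Fin m, if i ≤ j then n j else 0) ^ 2) *
            ∏ i : Fin m, qPochOne q (n i))⁻¹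

lemma w_cons (q : ℝ) (m a : ℕ) (v : Fin m → ℕ) :
    w q (m + 1) (Fin.cons a v) = q⁻¹ ^ ((a + ∑ i, v i) ^ 2) * u q⁻¹ a * w q m v := by
  rw [u_nat]
  simp only [w, Fin.sum_univ_succ, Fin.prod_univ_succ, Fin.cons_zero, Fin.cons_succ, qPochOne]
  simp only [Fin.zero_le, if_true, Fin.succ_le_succ_iff, Fin.le_zero_iff,
    Fin.succ_ne_zero, if_false, zero_add, pow_add, mul_inv, inv_pow]
  ring

lemma F_eq (q : ℝ) (m t : ℕ) :
    ∑ n ∈ Finset.Nat.antidiagonalTuple m t, w q m n = q⁻¹ ^ (t ^ 2) * B q⁻¹ m t := by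
  induction m generalizing t with
  | zero =>
    cases t with
    | zero => simp [w, B]
    | succ t => simp [B]
  | succ m ih =>
    have : ∑ n ∈ Finset.Nat.antidiagonalTuple (m + 1) t, w q (m + 1) n =
        ∑ p ∈ (Finset.range (t + 1)).sigma (fun j => Finset.Nat.antidiagonalTuple m j),
          q⁻¹ ^ (t ^ 2) * u q⁻¹ ((t : ℤ) - p.1) * w q m p.2 := by
      refine Finset.sum_bij' (fun n _ => ⟨∑ i, Fin.tail n i, Fin.tail n⟩)
        (fun p _ => Fin.cons (t - p.1) p.2) ?_ ?_ ?_ ?_ ?_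
      · intro n hn
        rw [Finset.Nat.mem_antidiagonalTuple, Fin.sum_univ_succ] at hn
        simp only [Finset.mem_sigma, Finset.mem_range, Finset.Nat.mem_antidiagonalTuple, and_true]
        simp only [Fin.tail]
        omega
      · rintro ⟨j, v⟩ hp
        simp only [Finset.mem_sigma, Finset.mem_range, Finset.Nat.mem_antidiagonalTuple] at hp ⊢
        rw [Fin.sum_univ_succ]
        simp only [Fin.cons_zero, Fin.cons_succ]
        omega
      · intro n hn
        rw [Finset.Nat.mem_antidiagonalTuple, Fin.sum_univ_succ] at hn
        conv_rhs => rw [← Fin.cons_self_tail n]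
        congr 1
        simp only [Fin.tail]
        omega
      · rintro ⟨j, v⟩ hp
        simp only [Finset.mem_sigma, Finset.mem_range, Finset.Nat.mem_antidiagonalTuple] at hp
        simp [Fin.tail_cons, hp.2]
      · intro n hn
        rw [Finset.Nat.mem_antidiagonalTuple, Fin.sum_univ_succ] at hn
        conv_lhs => rw [← Fin.cons_self_tail n]
        rw [w_cons]
        have e : n 0 + ∑ i, Fin.tail n i = t := hn
        have e' : (t : ℤ) - (∑ i, Fin.tail n i : ℕ) = n 0 := by omega
        simp only [e, e']
    rw [this, Finset.sum_sigma, B, Finset.mul_sum]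
    apply Finset.sum_congr rfl
    intro j _
    simp only
    rw [← Finset.mul_sum, ih]
    ring

lemma w_nonneg {q : ℝ} (hq : 1 < q) (m : ℕ) (n : Fin m → ℕ) : 0 ≤ w q m n := by
  have h0 : 0 < q⁻¹ := by positivity
  have h1 : q⁻¹ < 1 := inv_lt_one_of_one_lt₀ hq
  unfold w qPochOne
  apply inv_nonneg.mpr
  apply mul_nonneg (by positivity)
  exact Finset.prod_nonneg fun i _ => Finset.prod_nonneg fun j _ => (one_sub_pos h0 h1 j).le

lemma tsum_w {q : ℝ} (hq : 1 < q) (m : ℕ) (hm : 1 ≤ m) :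
    ∑' n : Fin m → ℕ, w q m n = ∑' j : ℕ, q⁻¹ ^ (j ^ 2) * B q⁻¹ m j := by
  have h0 : 0 < q⁻¹ := by positivity
  have h1 : q⁻¹ < 1 := inv_lt_one_of_one_lt₀ hq
  rw [← (Finset.Nat.sigmaAntidiagonalTupleEquivTuple m).tsum_eq]
  have fib : ∀ t : ℕ, ∑' v : Finset.Nat.antidiagonalTuple m t,
      w q m (Finset.Nat.sigmaAntidiagonalTupleEquivTuple m ⟨t, v⟩) = q⁻¹ ^ (t ^ 2) * B q⁻¹ m t := by
    intro t
    rw [← F_eq]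
    exact Finset.tsum_subtype (Finset.Nat.antidiagonalTuple m t) (w q m)
  rw [Summable.tsum_sigma]
  · exact tsum_congr fib
  · rw [summable_sigma_of_nonneg (fun _ => w_nonneg hq _ _)]
    refine ⟨fun t => (hasSum_fintype _).summable, ?_⟩
    exact ((S_summable h0 h1 m hm).of_norm).congr fun t => (fib t).symm

/-- good residues -/
def good (k : ℕ) : Set ℕ :=
  {r | 1 ≤ r ∧ ¬(r % (2 * k + 1) = 0 ∨ r % (2 * k + 1) = k ∨ r % (2 * k + 1) = k + 1)}

open Classical in
/-- factor restricted to good residues -/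
noncomputable def g (x : ℝ) (k r : ℕ) : ℝ := if r ∈ good k then 1 - x ^ r else 1

lemma block (x : ℝ) (k N : ℕ) (hk : 1 ≤ k) :
    ∏ i ∈ Finset.range (2 * k + 1), (1 - x ^ ((2 * k + 1) * N + i + 1)) =
      (∏ i ∈ Finset.range (2 * k + 1), g x k ((2 * k + 1) * N + i + 1)) *
      ((1 - x ^ ((2 * k + 1) * N + k)) * (1 - x ^ ((2 * k + 1) * N + k + 1)) *
        (1 - x ^ ((2 * k + 1) * (N + 1)))) := by
  classical
  let b : ℕ → ℝ := fun i => if i + 1 = k ∨ i = k ∨ i = 2 * k then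
    1 - x ^ ((2 * k + 1) * N + i + 1) else 1
  have h1 : ∏ i ∈ Finset.range (2 * k + 1), (1 - x ^ ((2 * k + 1) * N + i + 1)) =
      ∏ i ∈ Finset.range (2 * k + 1), (g x k ((2 * k + 1) * N + i + 1) * b i) := by
    apply Finset.prod_congr rfl
    intro i hi
    rw [Finset.mem_range] at hi
    have e : ((2 * k + 1) * N + i + 1) % (2 * k + 1) = (i + 1) % (2 * k + 1) := by
      rw [add_assoc, Nat.mul_add_mod]
    have hg : (2 * k + 1) * N + i + 1 ∈ good k ↔ ¬(i + 1 = k ∨ i = k ∨ i = 2 * k) := by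
      simp only [good, Set.mem_ofPred_eq, e]
      rcases Nat.lt_or_ge (i + 1) (2 * k + 1) with h | h
      · rw [Nat.mod_eq_of_lt h]; omega
      · have : i = 2 * k := by omega
        subst this
        simp
    simp only [g, b, hg]
    by_cases h : (i + 1 = k ∨ i = k ∨ i = 2 * k) <;> simp [h]
  rw [h1, Finset.prod_mul_distrib]
  congr 1
  have h2 : ∏ i ∈ {k - 1, k, 2 * k}, b i = ∏ i ∈ Finset.range (2 * k + 1), b i := by
    apply Finset.prod_subset
    · intro i; simp; omega
    · intro i _ hi
      simp only [Finset.mem_insert, Finset.mem_singleton] at hi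
      simp only [b]
      rw [if_neg (by omega)]
  rw [← h2, Finset.prod_insert (by simp only [Finset.mem_insert, Finset.mem_singleton]; omega),
    Finset.prod_insert (by simp only [Finset.mem_singleton]; omega), Finset.prod_singleton]
  have d1 : b (k - 1) = 1 - x ^ ((2 * k + 1) * N + k) := by
    simp only [b]
    rw [if_pos (Or.inl (by omega)), show (2 * k + 1) * N + (k - 1) + 1 = (2 * k + 1) * N + k by omega]
  have d2 : b k = 1 - x ^ ((2 * k + 1) * N + k + 1) := by simp [b]
  have d3 : b (2 * k) = 1 - x ^ ((2 * k + 1) * (N + 1)) := by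
    simp only [b]
    rw [if_pos (Or.inr (Or.inr trivial)),
      show (2 * k + 1) * N + 2 * k + 1 = (2 * k + 1) * (N + 1) by ring]
  rw [d1, d2, d3, ← mul_assoc]

lemma blocks {x : ℝ} (hx : x ≠ 0) (k n : ℕ) (hk : 1 ≤ k) :
    ∏ j ∈ Finset.range ((2 * k + 1) * n), (1 - x ^ (j + 1)) =
      (∏ j ∈ Finset.range ((2 * k + 1) * n), g x k (j + 1)) *
      (∏ i ∈ Finset.range n, (1 - (x ^ (2 * k + 1)) ^ (i + 1))) *
      ∏ i ∈ Finset.range n, ((1 - x ^ k * (x ^ (2 * k + 1)) ^ i) *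
        (1 - (x ^ (2 * k + 1)) ^ (i + 1) / x ^ k)) := by
  induction n with
  | zero => simp
  | succ n ih =>
    rw [mul_add, mul_one, Finset.prod_range_add _ ((2 * k + 1) * n),
      Finset.prod_range_add _ ((2 * k + 1) * n), ih]
    rw [ block x k n hk,
      Finset.prod_range_succ _ n, Finset.prod_range_succ _ n]
    have e1 : x ^ k * (x ^ (2 * k + 1)) ^ n = x ^ ((2 * k + 1) * n + k) := by
      rw [← pow_mul, ← pow_add]; congr 1; ring
    have e2 : (x ^ (2 * k + 1)) ^ (n + 1) / x ^ k = x ^ ((2 * k + 1) * n + k + 1) := by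
      rw [div_eq_iff (pow_ne_zero _ hx), ← pow_mul, ← pow_add]; congr 1; ring
    rw [e1, e2, ← pow_mul]
    ring

lemma c_eq_al {x : ℝ} (h0 : 0 < x) (k : ℕ) (r : ℤ) :
    c (x ^ (2 * k + 1)) (x ^ k) r = al x k r := by
  rw [al, c, c, one_zpow, mul_one, mul_assoc, mul_assoc]
  congr 1
  rw [← zpow_natCast, ← zpow_natCast x k, ← zpow_mul, ← zpow_mul, ← zpow_add₀ h0.ne',
    ← zpow_add₀ h0.ne']
  congr 1
  obtain ⟨s, hs⟩ : (2 : ℤ) ∣ r * (r - 1) := by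
    have := Int.even_mul_pred_self r
    exact this.two_dvd
  have : r * (r - 1) / 2 = s := by omega
  rw [this]
  push_cast
  have : r ^ 2 = 2 * s + r := by linarith [hs]
  rw [this]; ring

lemma g_mult {x : ℝ} (h0 : 0 < x) (h1 : x < 1) (k : ℕ) : Multipliable (g x k) := by
  classical
  have : Summable fun r : ℕ => ‖if r ∈ good k then -x ^ r else 0‖ := by
    refine Summable.of_nonneg_of_le (fun _ => norm_nonneg _) (fun r => ?_)
      (summable_geometric_of_lt_one h0.le h1)
    split_ifs
    · rw [norm_neg, Real.norm_of_nonneg (by positivity)]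
    · rw [norm_zero]; positivity
  refine (multipliable_one_add_of_summable this).congr fun r => ?_
  unfold g
  split_ifs <;> ring

lemma theta {x : ℝ} (h0 : 0 < x) (h1 : x < 1) (k : ℕ) (hk : 1 ≤ k) :
    (∑' r, al x k r) * (∏' r, g x k r) = P x := by
  set Q := x ^ (2 * k + 1) with hQ
  have Q0 : 0 < Q := by positivity
  have Q1 : Q < 1 := pow_lt_one₀ h0.le h1 (by omega)
  have a1 := tannery Q0 Q1 _ (al_summable h0 h1 k hk)
  have top : Tendsto (fun n => (2 * k + 1) * n) atTop atTop :=
    tendsto_id.const_mul_atTop' (by omega)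
  have a2 : Tendsto (fun n => ∏ j ∈ Finset.range ((2 * k + 1) * n), g x k (j + 1)) atTop
      (𝓝 (∏' r, g x k r)) := by
    have := (g_mult h0 h1 k).tendsto_prod_tprod_nat.comp ((tendsto_add_atTop_nat 1).comp top)
    refine this.congr fun n => ?_
    simp only [Function.comp]
    rw [Finset.prod_range_succ']
    simp [g, good]
  have a3 := P_tendsto Q0 Q1
  have a4 := (P_tendsto h0 h1).comp top
  have a5 : Tendsto (fun n : ℕ => u Q (2 * n : ℕ)) atTop (𝓝 (P Q)⁻¹) :=
    (u_tendsto Q0 Q1).comp (tendsto_natCast_atTop_atTop.comp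
      (tendsto_id.const_mul_atTop' (by omega)))
  have b1 := (a1.mul a2).mul a3
  have b2 := a4.mul a5
  have b3 := b1.congr' (f₂ := fun n : ℕ => (∏ j ∈ Finset.range ((2 * k + 1) * n), (1 - x ^ (j + 1)))
      * u Q (2 * n : ℕ)) (Eventually.of_forall fun n => by
    have := finite_jtp Q0 Q1 (pow_ne_zero k h0.ne') n
    simp only [hQ, c_eq_al h0] at this
    simp only [hQ, this, blocks h0.ne' k n hk]
    ring)
  have := tendsto_nhds_unique b3 b2
  have hP := (P_pos Q0 Q1).ne'
  field_simp at this
  linarith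

lemma prod_eq {x : ℝ} (h0 : 0 < x) (h1 : x < 1) (k : ℕ) (hk : 1 ≤ k) :
    ∏' r : good k, (1 - x ^ (r : ℕ))⁻¹ = (∏' r, g x k r)⁻¹ := by
  classical
  have hne : (∏' r, g x k r) ≠ 0 := by
    intro h
    have := theta h0 h1 k hk
    rw [h, mul_zero] at this
    exact (P_pos h0 h1).ne this
  rw [tprod_subtype (good k) (fun r => (1 - x ^ r)⁻¹), ← (g_mult h0 h1 k).tprod_inv₀ hne]
  apply tprod_congr
  intro r
  unfold g
  by_cases h : r ∈ good k <;> simp [h]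

end AG

/-- The Andrews–Gordon identity: for real `q > 1` and integer `k ≥ 2`,
`∑_{n₁,…,n_{k−1} ≥ 0} 1/(q^{N₁²+⋯+N_{k−1}²} (1/q)_{n₁}⋯(1/q)_{n_{k−1}})
  = ∏_{r ≥ 1, r ≢ 0, ±k (mod 2k+1)} 1/(1 − q^{−r})`,
where `Nᵢ = nᵢ + n_{i+1} + ⋯ + n_{k−1}`. -/
theorem andrews_gordon (q : ℝ) (hq : 1 < q) (k : ℕ) (hk : 2 ≤ k) :
    ∑' n : Fin (k - 1) → ℕ,
        (q ^ (∑ i : Fin (k - 1), (∑ j : Fin (k - 1), if i ≤ j then n j else 0) ^ 2) *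
            ∏ i : Fin (k - 1), qPochOne q (n i))⁻¹ =
      ∏' r : {r : ℕ //
          1 ≤ r ∧ ¬(r % (2 * k + 1) = 0 ∨ r % (2 * k + 1) = k ∨ r % (2 * k + 1) = k + 1)},
        (1 - q⁻¹ ^ (r : ℕ))⁻¹ := by
  have h0 : 0 < q⁻¹ := by positivity
  have h1 : q⁻¹ < 1 := inv_lt_one_of_one_lt₀ hq
  have L := AG.tsum_w hq (k - 1) (by omega)
  have R := AG.prod_eq h0 h1 k (by omega)
  have T := AG.theta h0 h1 k (by omega)
  have S := AG.S_eq h0 h1 (k - 1) (by omega)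
  rw [Nat.sub_add_cancel (by omega)] at S
  have hP := (AG.P_pos h0 h1).ne'
  refine L.trans (Eq.trans ?_ R.symm)
  rw [S, ← T, mul_inv]
  rw [← T] at hP
  have := left_ne_zero_of_mul hP
  rw [← mul_assoc, mul_inv_cancel₀ this, one_mul]
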